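/- Let M be a multi-agent MDP with n agents such that for every agent i and every fixed π_{-i} the projection Π_i(M,π_{-i}) has a unique optimal policy, and let σ be a permutation of {1,…,n}. If a joint policy π satisfies V^{M, JR_σ(π)}(s) = V^{M, π}(s) for every state s, then π is a fixed point of BR_i for every agent i ∈ {1,…,n}. -/

import Mathlib

open scoped ENNReal

/-- A (finite) Markov Decision Process with states `S`, actions `A`,
transition kernel `T`, reward `R` and discount factor `γ ∈ [0,1)`. -/
structure MDP (S A : Type) [Fintype S] [Nonempty S] [Fintype A] [Nonempty A] where
  T : S → A → PMF S
  R : S → A → ℝ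
  γ : ℝ
  γ_nonneg : 0 ≤ γ
  γ_lt_one : γ < 1

namespace MDP

variable {S A : Type} [Fintype S] [Nonempty S] [Fintype A] [Nonempty A]

/-- The distribution of the state at time `t` of the Markov chain induced by
policy `π`, started at `s₀`. -/
noncomputable def stateDist (M : MDP S A) (π : S → A) (s₀ : S) : ℕ → PMF S
  | 0 => PMF.pure s₀
  | t + 1 => (M.stateDist π s₀ t).bind fun s => M.T s (π s)

/-- The value of policy `π` at state `s₀`:
`V^{M,π}(s₀) = ∑_{t≥0} γ^t E[R(s_t, π(s_t))]`. -/
noncomputable def V (M : MDP S A) (π : S → A) (s₀ : S) : ℝ :=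
  ∑' t : ℕ, M.γ ^ t * ∑ s : S, ((M.stateDist π s₀ t) s).toReal * M.R s (π s)

/-- A policy `ρ` is optimal for `M` if it dominates every policy at every state. -/
def Optimal (M : MDP S A) (ρ : S → A) : Prop :=
  ∀ (ρ' : S → A) (s : S), M.V ρ' s ≤ M.V ρ s

end MDP

section MMDP

variable {S : Type} [Fintype S] [Nonempty S]
variable {n : ℕ} {A : Fin n → Type} [∀ i, Fintype (A i)] [∀ i, Nonempty (A i)]

/-- A joint policy `(π₁,…,π_n)` regarded as a single policy over joint actions. -/
def toPolicy (π : ∀ i, S → A i) : S → ∀ i, A i := fun s i => π i s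

/-- The `i`-th self-absorbed projection `Π_i(M, π_{-i})`: the single agent MDP for
agent `i` when the other agents act according to `π_{-i}`. -/
noncomputable def proj (M : MDP S (∀ i, A i)) (i : Fin n) (π : ∀ j, S → A j) :
    MDP S (A i) where
  T := fun s a => M.T s (Function.update (fun j => π j s) i a)
  R := fun s a => M.R s (Function.update (fun j => π j s) i a)
  γ := M.γ
  γ_nonneg := M.γ_nonneg
  γ_lt_one := M.γ_lt_one

/-- Given that each projection has a unique optimal policy, the `i`-th best
response operator replaces agent `i`'s policy by the optimal policy of
`Π_i(M, π_{-i})`. -/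
noncomputable def BR (M : MDP S (∀ i, A i))
    (hU : ∀ (i : Fin n) (π : ∀ j, S → A j), ∃! ρ : S → A i, (proj M i π).Optimal ρ)
    (i : Fin n) (π : ∀ j, S → A j) : ∀ j, S → A j :=
  Function.update π i (hU i π).choose

/-- A joint policy `π` is a Nash equilibrium if no unilateral deviation of a single
agent can increase the value at any state. -/
def Nash (M : MDP S (∀ i, A i)) (π : ∀ j, S → A j) : Prop :=
  ∀ (i : Fin n) (π' : S → A i) (s : S),
    M.V (toPolicy (Function.update π i π')) s ≤ M.V (toPolicy π) s

/-- The joint response operator `JR_σ = BR_{σ(n)} ∘ ⋯ ∘ BR_{σ(1)}`. -/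
noncomputable def JR (M : MDP S (∀ i, A i))
    (hU : ∀ (i : Fin n) (π : ∀ j, S → A j), ∃! ρ : S → A i, (proj M i π).Optimal ρ)
    (σ : Equiv.Perm (Fin n)) (π : ∀ j, S → A j) : ∀ j, S → A j :=
  (List.finRange n).foldl (fun p k => BR M hU (σ k) p) π

end MMDP

theorem toPolicy_update {S : Type} {n : ℕ} {A : Fin n → Type} (π : ∀ j, S → A j) (i : Fin n)
    (ρ : S → A i) (s : S) :
    toPolicy (Function.update π i ρ) s = Function.update (fun j => π j s) i (ρ s) := by
  funext j
  rcases eq_or_ne j i with rfl | hj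
  · simp [toPolicy]
  · simp [toPolicy, hj]

section MMDP

variable {S : Type} [Fintype S] [Nonempty S]
variable {n : ℕ} {A : Fin n → Type} [∀ i, Fintype (A i)] [∀ i, Nonempty (A i)]

theorem stateDist_proj (M : MDP S (∀ i, A i)) (i : Fin n) (π : ∀ j, S → A j)
    (ρ : S → A i) (s₀ : S) (t : ℕ) :
    (proj M i π).stateDist ρ s₀ t = M.stateDist (toPolicy (Function.update π i ρ)) s₀ t := by
  induction t with
  | zero => rfl
  | succ t ih => simp only [MDP.stateDist, ih, toPolicy_update]; rfl

/-- The value of a policy in the projection is the value of the joint policy it completes. -/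
theorem V_proj (M : MDP S (∀ i, A i)) (i : Fin n) (π : ∀ j, S → A j) (ρ : S → A i) (s : S) :
    (proj M i π).V ρ s = M.V (toPolicy (Function.update π i ρ)) s := by
  simp only [MDP.V, stateDist_proj, toPolicy_update]
  rfl

theorem V_le_V_BR (M : MDP S (∀ i, A i))
    (hU : ∀ (i : Fin n) (π : ∀ j, S → A j), ∃! ρ : S → A i, (proj M i π).Optimal ρ)
    (i : Fin n) (π : ∀ j, S → A j) (s : S) :
    M.V (toPolicy π) s ≤ M.V (toPolicy (BR M hU i π)) s := by
  simpa [V_proj, BR] using (hU i π).choose_spec.1 (π i) s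

theorem BR_eq_self_of_V_eq (M : MDP S (∀ i, A i))
    (hU : ∀ (i : Fin n) (π : ∀ j, S → A j), ∃! ρ : S → A i, (proj M i π).Optimal ρ)
    (i : Fin n) (π : ∀ j, S → A j)
    (h : ∀ s, M.V (toPolicy (BR M hU i π)) s = M.V (toPolicy π) s) :
    BR M hU i π = π := by
  have hopt : (proj M i π).Optimal (π i) := fun ρ s => by
    have hle := (hU i π).choose_spec.1 ρ s
    rw [V_proj _ _ _ (hU i π).choose] at hle
    rw [V_proj _ _ _ (π i), Function.update_eq_self, ← h s]
    exact hle
  have heq : π i = (hU i π).choose := (hU i π).choose_spec.2 _ hopt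
  rw [BR, ← heq, Function.update_eq_self]

theorem V_le_V_foldl_BR (M : MDP S (∀ i, A i))
    (hU : ∀ (i : Fin n) (π : ∀ j, S → A j), ∃! ρ : S → A i, (proj M i π).Optimal ρ)
    (f : Fin n → Fin n) (l : List (Fin n)) (π : ∀ j, S → A j) (s : S) :
    M.V (toPolicy π) s ≤ M.V (toPolicy (l.foldl (fun p k => BR M hU (f k) p) π)) s := by
  induction l generalizing π with
  | nil => exact le_rfl
  | cons k l ih => exact (V_le_V_BR M hU (f k) π s).trans (ih _)

theorem BR_eq_self_of_V_foldl_eq (M : MDP S (∀ i, A i))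
    (hU : ∀ (i : Fin n) (π : ∀ j, S → A j), ∃! ρ : S → A i, (proj M i π).Optimal ρ)
    (f : Fin n → Fin n) (l : List (Fin n)) (π : ∀ j, S → A j)
    (h : ∀ s, M.V (toPolicy (l.foldl (fun p k => BR M hU (f k) p) π)) s = M.V (toPolicy π) s) :
    ∀ k ∈ l, BR M hU (f k) π = π := by
  induction l with
  | nil => simp
  | cons k l ih =>
    rw [List.foldl_cons] at h
    have hk : BR M hU (f k) π = π := BR_eq_self_of_V_eq M hU (f k) π fun s =>
      le_antisymm ((V_le_V_foldl_BR M hU f l _ s).trans (h s).le) (V_le_V_BR M hU (f k) π s)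
    rw [hk] at h
    exact List.forall_mem_cons.2 ⟨hk, ih h⟩

end MMDP

/-- if the joint response `JR_σ` does not change the value at any state,
then `π` is a fixed point of `BR_i` for every agent `i`. -/
theorem BR_fixed_of_JR_value_eq
    {S : Type} [Fintype S] [Nonempty S] {n : ℕ} {A : Fin n → Type}
    [∀ i, Fintype (A i)] [∀ i, Nonempty (A i)]
    (M : MDP S (∀ i, A i))
    (hU : ∀ (i : Fin n) (π : ∀ j, S → A j), ∃! ρ : S → A i, (proj M i π).Optimal ρ)
    (σ : Equiv.Perm (Fin n)) (π : ∀ j, S → A j)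
    (h : ∀ s : S, M.V (toPolicy (JR M hU σ π)) s = M.V (toPolicy π) s) :
    ∀ i : Fin n, BR M hU i π = π := by
  intro i
  simpa using BR_eq_self_of_V_foldl_eq M hU σ (List.finRange n) π h (σ.symm i)
    (List.mem_finRange _)
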